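/- Let Δ > 0, ε' > 0 and ε > 0, and let μ = Lap(2Δ/ε') ⊗ Lap(4Δ/ε') ⊗ Lap(2Δ/ε) be the product of the three Laplace measures on ℝ³. For all reals T, t, α, v with α ≥ t ≥ 0 and v ≤ T − α, μ({(x,y,z) : v + y ≥ T − t + x and v + z ≥ T}) ≤ (1/2)·exp(−εα/(2Δ)) · (exp(−ε'(α−t)/(6Δ)) − (1/4)·exp(−ε'(α−t)/(3Δ))). (Type II error bound for one-off sieve-and-examine: the probability that a query with value at most T − α passes both the noisy sieve comparison and the noisy examine comparison.) -/

import Mathlib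

open MeasureTheory

/-- The Laplace measure `Lap(b)` on ℝ: the measure with density
`x ↦ (1/(2b)) · exp(−|x|/b)` with respect to Lebesgue measure. -/
noncomputable def laplaceMeasure (b : ℝ) : Measure ℝ :=
  volume.withDensity (fun x => ENNReal.ofReal ((1 / (2 * b)) * Real.exp (-|x| / b)))


lemma lap_Ici (b c : ℝ) (hb : 0 < b) (hc : 0 ≤ c) :
    laplaceMeasure b (Set.Ici c) = ENNReal.ofReal (1 / 2 * Real.exp (-c / b)) := by
  have hb' : -b⁻¹ < 0 := by simpa using hb
  rw [laplaceMeasure, withDensity_apply _ measurableSet_Ici]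
  have h1 : ∫⁻ x in Set.Ici c, ENNReal.ofReal ((1 / (2 * b)) * Real.exp (-|x| / b)) =
      ∫⁻ x in Set.Ici c, ENNReal.ofReal ((1 / (2 * b)) * Real.exp (-b⁻¹ * x)) := by
    refine setLIntegral_congr_fun measurableSet_Ici fun x hx => ?_
    have hx' : 0 ≤ x := hc.trans hx
    simp only [abs_of_nonneg hx']
    congr 3
    field_simp
  rw [h1, setLIntegral_congr (Ioi_ae_eq_Ici (a := c)).symm,
    ← ofReal_integral_eq_lintegral_ofReal ((integrableOn_exp_mul_Ioi hb' c).const_mul _)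
      (Filter.Eventually.of_forall fun x => by positivity),
    integral_const_mul, integral_exp_mul_Ioi hb']
  congr 1
  have : -b⁻¹ * c = -c / b := by field_simp
  rw [this]
  field_simp

lemma lap_Iic (b c : ℝ) (hb : 0 < b) (hc : 0 ≤ c) :
    laplaceMeasure b (Set.Iic (-c)) = ENNReal.ofReal (1 / 2 * Real.exp (-c / b)) := by
  have hb' : 0 < b⁻¹ := by simpa using hb
  rw [laplaceMeasure, withDensity_apply _ measurableSet_Iic]
  have h1 : ∫⁻ x in Set.Iic (-c), ENNReal.ofReal ((1 / (2 * b)) * Real.exp (-|x| / b)) =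
      ∫⁻ x in Set.Iic (-c), ENNReal.ofReal ((1 / (2 * b)) * Real.exp (b⁻¹ * x)) := by
    refine setLIntegral_congr_fun measurableSet_Iic fun x hx => ?_
    have hx' : x ≤ 0 := by have : x ≤ -c := hx
                           linarith
    simp only [abs_of_nonpos hx']
    congr 3
    field_simp
  rw [h1,
    ← ofReal_integral_eq_lintegral_ofReal ((integrableOn_exp_mul_Iic hb' (-c)).const_mul _)
      (Filter.Eventually.of_forall fun x => by positivity),
    integral_const_mul, integral_exp_mul_Iic hb']
  congr 1
  have : b⁻¹ * -c = -c / b := by field_simp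
  rw [this]
  field_simp

lemma lap_prob (b : ℝ) (hb : 0 < b) : IsProbabilityMeasure (laplaceMeasure b) := by
  constructor
  have h0 : laplaceMeasure b (Set.Ioi 0) = laplaceMeasure b (Set.Ici 0) :=
    measure_congr ((withDensity_absolutelyContinuous _ _).ae_eq Ioi_ae_eq_Ici)
  rw [← Set.Iic_union_Ioi (a := (0:ℝ)), measure_union (by simp) measurableSet_Ioi, h0,
    lap_Ici b 0 hb le_rfl]
  have := lap_Iic b 0 hb le_rfl
  rw [neg_zero] at this
  rw [this, ← ENNReal.ofReal_add (by positivity) (by positivity)]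
  norm_num

theorem stmt_18 (Δ ε' ε : ℝ) (hΔ : 0 < Δ) (hε' : 0 < ε') (hε : 0 < ε)
    (T t α v : ℝ) (ht : 0 ≤ t) (hαt : t ≤ α) (hv : v ≤ T - α) :
    ((laplaceMeasure (2 * Δ / ε')).prod (laplaceMeasure (4 * Δ / ε'))).prod
        (laplaceMeasure (2 * Δ / ε))
        {p : (ℝ × ℝ) × ℝ | T - t + p.1.1 ≤ v + p.1.2 ∧ T ≤ v + p.2} ≤
      ENNReal.ofReal ((1 / 2) * Real.exp (-(ε * α) / (2 * Δ)) *
        (Real.exp (-(ε' * (α - t)) / (6 * Δ)) -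
          (1 / 4) * Real.exp (-(ε' * (α - t)) / (3 * Δ)))) := by
  have hb1 : 0 < 2 * Δ / ε' := by positivity
  have hb2 : 0 < 4 * Δ / ε' := by positivity
  have hb3 : 0 < 2 * Δ / ε := by positivity
  have := lap_prob _ hb1
  have := lap_prob _ hb2
  have := lap_prob _ hb3
  set s := α - t with hs
  have hs0 : 0 ≤ s := by linarith
  have hα : 0 ≤ α := by linarith
  set e := Real.exp (-(ε' * s) / (6 * Δ)) with he
  have he0 : 0 < e := Real.exp_pos _
  have he1 : e ≤ 1 := by
    rw [he, Real.exp_le_one_iff]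
    apply div_nonpos_of_nonpos_of_nonneg _ (by positivity)
    have : 0 ≤ ε' * s := by positivity
    linarith
  have he2 : Real.exp (-(ε' * s) / (3 * Δ)) = e * e := by
    rw [he, ← Real.exp_add]
    congr 1
    field_simp
    ring
  have hA : laplaceMeasure (2 * Δ / ε') (Set.Iic (-(s / 3))) = ENNReal.ofReal (1 / 2 * e) := by
    rw [lap_Iic _ _ hb1 (by positivity), he]
    congr 3
    field_simp
    ring
  have hB : laplaceMeasure (4 * Δ / ε') (Set.Ici (2 * s / 3)) = ENNReal.ofReal (1 / 2 * e) := by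
    rw [lap_Ici _ _ hb2 (by positivity), he]
    congr 3
    field_simp
    ring
  have hC : laplaceMeasure (2 * Δ / ε) (Set.Ici α) =
      ENNReal.ofReal (1 / 2 * Real.exp (-(ε * α) / (2 * Δ))) := by
    rw [lap_Ici _ _ hb3 hα]
    congr 3
    field_simp
  have hAc : laplaceMeasure (2 * Δ / ε') (Set.Iic (-(s / 3)))ᶜ =
      ENNReal.ofReal (1 - 1 / 2 * e) := by
    rw [prob_compl_eq_one_sub measurableSet_Iic, hA, ENNReal.ofReal_sub _ (by positivity),
      ENNReal.ofReal_one]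
  have hsub : {p : (ℝ × ℝ) × ℝ | T - t + p.1.1 ≤ v + p.1.2 ∧ T ≤ v + p.2} ⊆
      ((Set.Iic (-(s / 3)) ×ˢ Set.univ) ∪ ((Set.Iic (-(s / 3)))ᶜ ×ˢ Set.Ici (2 * s / 3)))
        ×ˢ Set.Ici α := by
    rintro ⟨⟨x, y⟩, z⟩ ⟨h1, h2⟩
    simp only [Set.mem_prod, Set.mem_union, Set.mem_Iic, Set.mem_univ, Set.mem_compl_iff,
      Set.mem_Ici] at h1 h2 ⊢
    refine ⟨?_, by linarith⟩
    by_cases hx : x ≤ -(s / 3)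
    · exact Or.inl ⟨hx, trivial⟩
    · refine Or.inr ⟨hx, ?_⟩
      linarith
  refine (measure_mono hsub).trans ?_
  rw [Measure.prod_prod, hC, mul_comm,
    ENNReal.ofReal_mul (p := 1 / 2 * Real.exp (-(ε * α) / (2 * Δ))) (by positivity)]
  gcongr
  refine (measure_union_le _ _).trans ?_
  rw [Measure.prod_prod, Measure.prod_prod, hA, hAc, hB, measure_univ, mul_one,
    ← ENNReal.ofReal_mul (by linarith), ← ENNReal.ofReal_add (by positivity)
      (mul_nonneg (by linarith) (by positivity)), he2]
  apply ENNReal.ofReal_le_ofReal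
  apply le_of_eq
  ring
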